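/- On the invariant set M₀ = {G = 0} of the Goryachev–Chaplygin problem, the image of the integral map (H, K) is exactly the set {(h,k) : h ≥ (3/2)(2|k|)^{2/3} − 1}; in particular, for every pair (h,k) with h > (3/2)(2|k|)^{2/3} − 1 and also for boundary pairs, there exists (ν,ω) with ‖ν‖ = 1, G(ν,ω) = 0, H(ν,ω) = h, K(ν,ω) = k. -/

import Mathlib

lemma gc_lower (a b c p q r x : ℝ) (hx : 0 ≤ x) (hn : a^2 + b^2 + c^2 = 1)
    (hG : 4*(p*a + q*b) + r*c = 0) (hk : x^3 = 2*(r*(p^2+q^2) + p*c)) :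
    (3/2) * x^2 - 1 ≤ 2*(p^2+q^2) + (1/2)*r^2 - a := by
  obtain ⟨s, hs0, hs⟩ : ∃ s : ℝ, 0 ≤ s ∧ s^2 + r*s = 4*(p^2+q^2) := by
    have h1 : 0 ≤ r^2 + 16*(p^2+q^2) := by positivity
    have h2 := Real.sq_sqrt h1
    have h3 : r ≤ Real.sqrt (r^2 + 16*(p^2+q^2)) := by
      apply Real.le_sqrt_of_sq_le
      nlinarith [sq_nonneg p, sq_nonneg q]
    exact ⟨(-r + Real.sqrt (r^2 + 16*(p^2+q^2)))/2, by linarith, by nlinarith⟩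
  have ha : a ≤ 1 := by nlinarith [sq_nonneg b, sq_nonneg c]
  rcases hs0.eq_or_lt with h0 | h0
  · subst h0
    have hp : p = 0 := by nlinarith [sq_nonneg p, sq_nonneg q]
    have hq : q = 0 := by nlinarith [sq_nonneg p, sq_nonneg q]
    subst hp hq
    have : x = 0 := by
      have : x^3 = 0 := by rw [hk]; ring
      exact pow_eq_zero_iff (by norm_num) |>.1 this
    subst this
    nlinarith [sq_nonneg r]
  · have hD : 0 < 4*(p^2+q^2) + s^2 := by positivity
    set D := 4*(p^2+q^2) + s^2 with hDd
    have hnn : (D - 8*p^2)^2 + (8*p*q)^2 + (4*p*s)^2 = D^2 := by rw [hDd]; ring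
    have hdot : (D - 8*p^2)*a - 8*p*q*b + 4*p*s*c ≤ D := by
      have := sq_nonneg ((D - 8*p^2) - D*a)
      have := sq_nonneg (8*p*q + D*b)
      have := sq_nonneg (4*p*s - D*c)
      have e : D^2*(a^2+b^2+c^2) = D^2 := by rw [hn]; ring
      have : D*((D - 8*p^2)*a - 8*p*q*b + 4*p*s*c) ≤ D*D := by nlinarith
      exact le_of_mul_le_mul_left this hD
    have e2 : D*(s*a + 2*p*c) = s*((D - 8*p^2)*a - 8*p*q*b + 4*p*s*c) := by
      rw [hDd]
      linear_combination (2*p*s)*hG - (2*p*c)*hs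
    have h4 : s*a + 2*p*c ≤ s := by
      have : D*(s*a + 2*p*c) ≤ D*s := by rw [e2]; nlinarith
      exact le_of_mul_le_mul_left this hD
    have e3 : s^3 - 2*(2*(p^2+q^2) + (1/2)*r^2 - a)*s + 2*x^3 = 2*(s*a+2*p*c) := by
      rw [hk]; linear_combination (s-r)*hs
    have h5 : 0 ≤ (s-x)^2*(s+2*x) := by positivity
    have h6 : s*((3/2) * x^2 - 1) ≤ s*(2*(p^2+q^2) + (1/2)*r^2 - a) := by nlinarith
    exact le_of_mul_le_mul_left h6 h0

lemma gc_root (y : ℝ) (hy : 0 ≤ y) : ∃ x : ℝ, 0 ≤ x ∧ x^3 = y ∧ y ^ ((2:ℝ)/3) = x^2 := by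
  refine ⟨y ^ ((1:ℝ)/3), by positivity, ?_, ?_⟩
  · rw [← Real.rpow_natCast, ← Real.rpow_mul hy]; norm_num
  · rw [← Real.rpow_natCast, ← Real.rpow_mul hy]; norm_num

lemma gc_exists (h x : ℝ) (hx : 0 ≤ x) (hh : (3/2)*x^2 - 1 ≤ h) :
    ∃ t q : ℝ, 2*q^2 + (1/2)*t^2 - 1 = h ∧ t*q^2 = x^3/2 := by
  rcases hx.eq_or_lt with h0 | h0
  · subst h0
    refine ⟨0, Real.sqrt ((h+1)/2), ?_, by norm_num⟩
    rw [Real.sq_sqrt (by linarith)]; ring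
  · set T := x + 2*(h+1)/x + 1 with hT
    have hh1 : 0 ≤ h + 1 := by nlinarith [sq_nonneg x]
    have hxT : x ≤ T := by
      have : 0 ≤ 2*(h+1)/x := by positivity
      linarith
    have hc : ContinuousOn (fun t : ℝ => t^3 + 2*x^3 - 2*(h+1)*t) (Set.Icc x T) := by fun_prop
    have hTT : 2*(h+1) ≤ T*x := by
      have : T*x = x^2 + 2*(h+1) + x := by rw [hT]; field_simp
      nlinarith
    have := intermediate_value_Icc hxT hc (show (0:ℝ) ∈ _ from ⟨by
      show x^3 + 2*x^3 - 2*(h+1)*x ≤ 0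
      nlinarith [mul_le_mul_of_nonneg_left hh hx], by
      show 0 ≤ T^3 + 2*x^3 - 2*(h+1)*T
      have hT0 : 0 ≤ T := by linarith
      have : T*(2*(h+1)) ≤ T*(T*T) := by
        apply mul_le_mul_of_nonneg_left _ hT0
        nlinarith
      have : 0 ≤ x^3 := by positivity
      nlinarith⟩)
    obtain ⟨t, ⟨ht, -⟩, hte⟩ := this
    have ht0 : 0 < t := by linarith
    simp only at hte
    refine ⟨t, Real.sqrt (x^3/2/t), ?_, ?_⟩
    · rw [Real.sq_sqrt (by positivity)]
      field_simp
      linarith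
    · rw [Real.sq_sqrt (by positivity)]
      field_simp


/-- Goryachev–Chaplygin case: on `M₀ = {‖ν‖ = 1, G = 0}` the image of the
integral map `(H, K)` is exactly `{(h,k) : h ≥ (3/2)(2|k|)^{2/3} − 1}`. -/
theorem goryachev_chaplygin_integral_map_image :
    (∀ ν1 ν2 ν3 ω1 ω2 ω3 : ℝ,
      ν1^2 + ν2^2 + ν3^2 = 1 →
      4*(ω1*ν1 + ω2*ν2) + ω3*ν3 = 0 →
      (3/2) * (2 * |ω3*(ω1^2 + ω2^2) + ω1*ν3|) ^ ((2:ℝ)/3) - 1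
        ≤ 2*(ω1^2 + ω2^2) + (1/2)*ω3^2 - ν1) ∧
    (∀ h k : ℝ, (3/2) * (2 * |k|) ^ ((2:ℝ)/3) - 1 ≤ h →
      ∃ ν1 ν2 ν3 ω1 ω2 ω3 : ℝ,
        ν1^2 + ν2^2 + ν3^2 = 1 ∧
        4*(ω1*ν1 + ω2*ν2) + ω3*ν3 = 0 ∧
        2*(ω1^2 + ω2^2) + (1/2)*ω3^2 - ν1 = h ∧
        ω3*(ω1^2 + ω2^2) + ω1*ν3 = k) := by

  constructor
  · intro a b c p q r hn hG
    obtain ⟨x, hx, h3, h2⟩ := gc_root (2 * |r*(p^2 + q^2) + p*c|) (by positivity)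
    rw [h2]
    rcases abs_cases (r*(p^2 + q^2) + p*c) with ⟨e, -⟩ | ⟨e, -⟩
    · rw [e] at h3
      exact gc_lower a b c p q r x hx hn hG h3
    · rw [e] at h3
      have := gc_lower a b c (-p) (-q) (-r) x hx hn (by linarith) (by rw [h3]; ring)
      simpa only [neg_sq] using this
  · intro h k hh
    obtain ⟨x, hx, h3, h2⟩ := gc_root (2 * |k|) (by positivity)
    rw [h2] at hh
    obtain ⟨t, q, e1, e2⟩ := gc_exists h x hx hh
    rcases abs_cases k with ⟨e, -⟩ | ⟨e, -⟩
    · rw [e] at h3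
      exact ⟨1, 0, 0, 0, q, t, by norm_num, by norm_num, by linarith, by linarith⟩
    · rw [e] at h3
      exact ⟨1, 0, 0, 0, q, -t, by norm_num, by norm_num, by linarith, by linarith⟩
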